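/- arXiv:2208.12522 — 6 statements merged into one kernel-verified Lean document; each statement's English description precedes it below -/
import Mathlib

section
/- There exists f_D in the finite-dimensional subspace V = span{Φ(x₁), …, Φ(x_N)} that is a global minimizer of J over all of H, i.e. J(f_D) ≤ J(f) for every f ∈ H. -/
open scoped RealInnerProductSpace

/-- On a proper space, a lower semicontinuous function that is nowhere below its value at `a`
outside some closed ball around `a` attains its minimum. -/
theorem LowerSemicontinuous.exists_forall_le_of_forall_dist_gt {E : Type*} [PseudoMetricSpace E]
    [ProperSpace E] {g : E → ℝ} (hg : LowerSemicontinuous g) {a : E} {R : ℝ} (hR : 0 ≤ R)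
    (h : ∀ v, R < dist v a → g a ≤ g v) : ∃ v, ∀ w, g v ≤ g w := by
  obtain ⟨v, -, hv⟩ := (hg.lowerSemicontinuousOn (Metric.closedBall a R)).exists_isMinOn
    ⟨a, Metric.mem_closedBall_self hR⟩ (isCompact_closedBall a R)
  rw [isMinOn_iff] at hv
  refine ⟨v, fun w => ?_⟩
  rcases le_or_gt (dist w a) R with hw | hw
  · exact hv w hw
  · exact (hv a (Metric.mem_closedBall_self hR)).trans (h w hw)

/-- **Representer theorem for SVM with lower semicontinuous loss** (Proposition 3.1):
there exists a global minimizer of the regularized empirical risk `J` lying in the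
finite-dimensional subspace spanned by `Φ(x₁), …, Φ(x_N)`. -/
theorem representer_theorem_lsc
    {H : Type*} [NormedAddCommGroup H] [InnerProductSpace ℝ H] [CompleteSpace H]
    {X : Type*} (Φ : X → H) (N : ℕ) (hN : 0 < N) (x : Fin N → X)
    (L : Fin N → ℝ → ℝ) (hL0 : ∀ i t, 0 ≤ L i t)
    (hLlsc : ∀ i, LowerSemicontinuous (L i))
    (lam : ℝ) (hlam : 0 < lam)
    (J : H → ℝ)
    (hJ : ∀ f, J f = (1 / (N : ℝ)) * ∑ i, L i ⟪f, Φ (x i)⟫ + lam * ‖f‖ ^ 2) :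
    ∃ fD ∈ Submodule.span ℝ (Set.range fun i => Φ (x i)), ∀ f : H, J fD ≤ J f := by
  set V := Submodule.span ℝ (Set.range fun i => Φ (x i))
  have : FiniteDimensional ℝ V := FiniteDimensional.span_of_finite ℝ (Set.finite_range _)
  have : ProperSpace V := FiniteDimensional.proper ℝ V
  have loss_nonneg (f : H) : 0 ≤ (1 / (N : ℝ)) * ∑ i, L i ⟪f, Φ (x i)⟫ :=
    mul_nonneg (by positivity) (Finset.sum_nonneg fun i _ => hL0 i _)
  have hJ_lsc : LowerSemicontinuous fun v : V => J v := by
    simp only [hJ]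
    refine LowerSemicontinuous.add ?_ (Continuous.lowerSemicontinuous (by fun_prop))
    have hsum : LowerSemicontinuous fun v : V => ∑ i, L i ⟪(v : H), Φ (x i)⟫ :=
      lowerSemicontinuous_sum fun i _ => (hLlsc i).comp (by fun_prop)
    exact (continuous_const_mul (1 / (N : ℝ))).comp_lowerSemicontinuous hsum
      (monotone_mul_left_of_nonneg (by positivity))
  obtain ⟨v, hv⟩ := hJ_lsc.exists_forall_le_of_forall_dist_gt (a := 0)
    (Real.sqrt_nonneg (J 0 / lam)) fun w hw => by
      rw [dist_zero_right, Submodule.coe_norm] at hw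
      have hlt : J 0 < lam * ‖(w : H)‖ ^ 2 := by
        rw [← div_lt_iff₀' hlam]
        exact Real.lt_sq_of_sqrt_lt hw
      rw [ZeroMemClass.coe_zero, hJ w]
      linarith [loss_nonneg w]
  refine ⟨v, v.2, fun f => (hv (V.orthogonalProjectionOnto f)).trans ?_⟩
  have hinner (i : Fin N) : ⟪(V.orthogonalProjectionOnto f : H), Φ (x i)⟫ = ⟪f, Φ (x i)⟫ := by
    have h := V.starProjection_inner_eq_zero f (Φ (x i)) (Submodule.subset_span ⟨i, rfl⟩)
    rw [inner_sub_left, sub_eq_zero] at h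
    exact h.symm
  have hnorm : ‖(V.orthogonalProjectionOnto f : H)‖ ≤ ‖f‖ :=
    V.norm_orthogonalProjectionOnto_apply_le f
  rw [hJ, hJ f]
  simp only [hinner]
  gcongr
end

section
/- Let P denote the orthogonal projection of H onto V. Then for every f ∈ H one has ⟨Pf, Φ(xᵢ)⟩ = ⟨f, Φ(xᵢ)⟩ for each i = 1, …, N, and J(Pf) ≤ J(f). -/
open scoped RealInnerProductSpace

/-- **Projection step of the representer theorem**: if `P` is the orthogonal projection of
`H` onto `V = span{Φ(x₁), …, Φ(x_N)}` (characterized by `P f ∈ V` and `f - P f ∈ Vᗮ`),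
then `P f` has the same inner products with the kernel sections as `f`, and
`J (P f) ≤ J f`. -/
theorem orthogonal_projection_reduces_regularized_risk
    {H : Type*} [NormedAddCommGroup H] [InnerProductSpace ℝ H] [CompleteSpace H]
    {X : Type*} (Φ : X → H) (N : ℕ) (hN : 0 < N) (x : Fin N → X)
    (L : Fin N → ℝ → ℝ) (hL0 : ∀ i t, 0 ≤ L i t)
    (lam : ℝ) (hlam : 0 < lam)
    (J : H → ℝ)
    (hJ : ∀ f, J f = (1 / (N : ℝ)) * ∑ i, L i ⟪f, Φ (x i)⟫ + lam * ‖f‖ ^ 2)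
    (V : Submodule ℝ H) (hV : V = Submodule.span ℝ (Set.range fun i => Φ (x i)))
    (P : H → H) (hP : ∀ f, P f ∈ V ∧ f - P f ∈ Vᗮ) :
    ∀ f : H, (∀ i, ⟪P f, Φ (x i)⟫ = ⟪f, Φ (x i)⟫) ∧ J (P f) ≤ J f := by
  intro f
  obtain ⟨hPV, hPorth⟩ := hP f
  have h_inner : ∀ i, ⟪P f, Φ (x i)⟫ = ⟪f, Φ (x i)⟫ := by
    intro i
    have hmem : Φ (x i) ∈ V := hV ▸ Submodule.subset_span ⟨i, rfl⟩
    have h := Submodule.inner_left_of_mem_orthogonal hmem hPorth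
    rw [inner_sub_left] at h
    linarith
  have h_norm : ‖P f‖ ^ 2 ≤ ‖f‖ ^ 2 := by
    have h := norm_add_sq_real (P f) (f - P f)
    rw [add_sub_cancel, Submodule.inner_right_of_mem_orthogonal hPV hPorth] at h
    nlinarith [sq_nonneg ‖f - P f‖]
  refine ⟨h_inner, ?_⟩
  simp only [hJ, h_inner]
  gcongr
end

section
/- Define h(t) = (1/N)·max{0, 1 − t} + (ρ/2)(t − u)² for t ∈ ℝ. Then the unique global minimizer t* of h over ℝ is given by: t* = u + 1/(ρN) if u < 1 − 1/(ρN); t* = 1 if 1 − 1/(ρN) ≤ u < 1; and t* = u if u ≥ 1. -/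
/-- Quadratic growth of the scaled Hinge proximal objective around its minimizer. -/
theorem hinge_prox_quadratic_growth {c u p : ℝ} (hc : 0 ≤ c)
    (hp : p = if u < 1 - c then u + c else if u < 1 then 1 else u) (t : ℝ) :
    c * max 0 (1 - p) + (p - u) ^ 2 / 2 + (t - p) ^ 2 / 2
      ≤ c * max 0 (1 - t) + (t - u) ^ 2 / 2 := by
  have hmax_nonneg : 0 ≤ max 0 (1 - t) := le_max_left _ _
  have hmax_ge : 1 - t ≤ max 0 (1 - t) := le_max_right _ _
  split_ifs at hp with h₁ h₂
  · subst hp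
    rw [max_eq_right (by linarith : (0 : ℝ) ≤ 1 - (u + c))]
    nlinarith [mul_le_mul_of_nonneg_left hmax_ge hc]
  · subst hp
    rw [sub_self, max_self]
    nlinarith [mul_le_mul_of_nonneg_left hmax_ge (by linarith : 0 ≤ 1 - u),
      mul_le_mul_of_nonneg_right (by linarith : 1 - u ≤ c) hmax_nonneg]
  · subst hp
    rw [max_eq_left (by linarith : 1 - p ≤ 0)]
    nlinarith [mul_nonneg hc hmax_nonneg]

/-- **Closed-form solution of the one-dimensional ADMM subproblem (S-1'') for the Hinge
loss** (case `y = +1`): the unique global minimizer of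
`h(t) = (1/N)·max{0, 1 − t} + (ρ/2)(t − u)²` is `u + 1/(ρN)` if `u < 1 − 1/(ρN)`,
`1` if `1 − 1/(ρN) ≤ u < 1`, and `u` if `u ≥ 1`. -/
theorem hinge_prox_closed_form
    (N : ℕ) (hN : 0 < N) (ρ u : ℝ) (hρ : 0 < ρ)
    (h : ℝ → ℝ)
    (hdef : ∀ t, h t = (1 / (N : ℝ)) * max 0 (1 - t) + ρ / 2 * (t - u) ^ 2)
    (tstar : ℝ)
    (htstar : tstar =
      if u < 1 - 1 / (ρ * N) then u + 1 / (ρ * N)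
      else if u < 1 then 1
      else u) :
    (∀ t : ℝ, h tstar ≤ h t) ∧ ∀ s : ℝ, (∀ t : ℝ, h s ≤ h t) → s = tstar := by
  have hN' : (0 : ℝ) < N := Nat.cast_pos.mpr hN
  have hscale : 1 / (N : ℝ) = ρ * (1 / (ρ * N)) := by field_simp
  have growth (t : ℝ) : h tstar + ρ / 2 * (t - tstar) ^ 2 ≤ h t := by
    have key := mul_le_mul_of_nonneg_left
      (hinge_prox_quadratic_growth (by positivity) htstar t) hρ.le
    rw [hdef, hdef, hscale]
    linarith
  refine ⟨fun t => ?_, fun s hs => ?_⟩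
  · have : 0 ≤ ρ / 2 * (t - tstar) ^ 2 := by positivity
    linarith [growth t]
  · by_contra hne
    have : 0 < ρ / 2 * (s - tstar) ^ 2 :=
      mul_pos (half_pos hρ) (sq_pos_of_ne_zero (sub_ne_zero.mpr hne))
    linarith [growth s, hs tstar]
end

section
/- Define h(t) = (1/N)·min{1, max{0, 1 − t}} + (ρ/2)(t − u)² for t ∈ ℝ, and assume 0 < 1/(ρN) < 2. Then: (i) if u < −1/(2ρN), then u is a global minimizer of h; (ii) if u = −1/(2ρN), then both u and u + 1/(ρN) are global minimizers of h; (iii) if −1/(2ρN) < u ≤ 1 − 1/(ρN), then u + 1/(ρN) is a global minimizer of h; (iv) if 1 − 1/(ρN) < u < 1, then 1 is a global minimizer of h; (v) if u ≥ 1, then u is a global minimizer of h. -/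
/-- The ramp function `min 1 (max 0 (1 - t))` is constant, affine and zero on three pieces. -/
theorem ramp_cases (t : ℝ) :
    (t ≤ 0 ∧ min 1 (max 0 (1 - t)) = 1) ∨
    (0 ≤ t ∧ t ≤ 1 ∧ min 1 (max 0 (1 - t)) = 1 - t) ∨
    (1 ≤ t ∧ min 1 (max 0 (1 - t)) = 0) := by
  grind

/-- **Closed-form solution of the one-dimensional ADMM subproblem (S-1'') for the ramp
loss** (case `y = +1`, assuming `0 < 1/(ρN) < 2`), where
`h(t) = (1/N)·min{1, max{0, 1 − t}} + (ρ/2)(t − u)²`. -/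
theorem ramp_prox_closed_form
    (N : ℕ) (hN : 0 < N) (ρ u : ℝ) (hρ : 0 < ρ)
    (hsmall : 0 < 1 / (ρ * N) ∧ 1 / (ρ * N) < 2)
    (h : ℝ → ℝ)
    (hdef : ∀ t, h t = (1 / (N : ℝ)) * min 1 (max 0 (1 - t)) + ρ / 2 * (t - u) ^ 2) :
    (u < -(1 / (2 * ρ * N)) → ∀ t : ℝ, h u ≤ h t) ∧
    (u = -(1 / (2 * ρ * N)) →
      (∀ t : ℝ, h u ≤ h t) ∧ (∀ t : ℝ, h (u + 1 / (ρ * N)) ≤ h t)) ∧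
    (-(1 / (2 * ρ * N)) < u ∧ u ≤ 1 - 1 / (ρ * N) →
      ∀ t : ℝ, h (u + 1 / (ρ * N)) ≤ h t) ∧
    (1 - 1 / (ρ * N) < u ∧ u < 1 → ∀ t : ℝ, h 1 ≤ h t) ∧
    (1 ≤ u → ∀ t : ℝ, h u ≤ h t) := by
  obtain ⟨hd0, hd2⟩ := hsmall
  have hN' : (0 : ℝ) < N := by exact_mod_cast hN
  have e1 : 1 / (2 * ρ * N) = 1 / (ρ * N) / 2 := by field_simp
  have e2 : 1 / (N : ℝ) = ρ * (1 / (ρ * N)) := by field_simp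
  rw [e1]
  rw [e2] at hdef
  generalize 1 / (ρ * (N : ℝ)) = d at *
  have hle : ∀ s t, d * min 1 (max 0 (1 - s)) + (s - u) ^ 2 / 2 ≤
      d * min 1 (max 0 (1 - t)) + (t - u) ^ 2 / 2 → h s ≤ h t := by
    intro s t hst
    rw [hdef, hdef]
    linarith [mul_le_mul_of_nonneg_left hst hρ.le]
  have left : u ≤ -(d / 2) → ∀ t, h u ≤ h t := by
    intro hu t
    apply hle
    have hm : min 1 (max 0 (1 - u)) = 1 := by grind
    rw [hm]
    rcases ramp_cases t with ⟨ht, e⟩ | ⟨ht, ht1, e⟩ | ⟨ht, e⟩ <;> rw [e]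
    · nlinarith [sq_nonneg (t - u)]
    · nlinarith [sq_nonneg (t - u - d)]
    · nlinarith [sq_nonneg (t - u - d), sq_nonneg (1 - d / 2)]
  have middle : -(d / 2) ≤ u → u ≤ 1 - d → ∀ t, h (u + d) ≤ h t := by
    intro hu hu1 t
    apply hle
    have hm : min 1 (max 0 (1 - (u + d))) = 1 - (u + d) := by grind
    rw [hm]
    rcases ramp_cases t with ⟨ht, e⟩ | ⟨ht, ht1, e⟩ | ⟨ht, e⟩ <;> rw [e]
    · nlinarith [sq_nonneg (t - u)]
    · nlinarith [sq_nonneg (t - u - d)]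
    · nlinarith [sq_nonneg (t - u - d)]
  refine ⟨fun hu => left hu.le, fun hu => ⟨left hu.le, middle hu.ge (by linarith)⟩,
    fun hu => middle hu.1.le hu.2, ?_, ?_⟩
  · rintro ⟨hu, hu1⟩ t
    apply hle
    have hm : min 1 (max 0 (1 - (1 : ℝ))) = 0 := by norm_num
    rw [hm]
    rcases ramp_cases t with ⟨ht, e⟩ | ⟨ht, ht1, e⟩ | ⟨ht, e⟩ <;> rw [e]
    · nlinarith [sq_nonneg (t - u)]
    · nlinarith [mul_nonneg (sub_nonneg.2 ht1) (sub_nonneg.2 hu.le), sq_nonneg (1 - t)]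
    · nlinarith
  · intro hu t
    apply hle
    have hm : min 1 (max 0 (1 - u)) = 0 := by grind
    rw [hm]
    have hnn : 0 ≤ min 1 (max 0 (1 - t)) := by positivity
    nlinarith [sq_nonneg (t - u), mul_nonneg hd0.le hnn]
end

section
/- For every k ≥ 0, the ADMM iterates satisfy (ρ/2)‖A(c^{k+1} − c^k)‖² ≤ L_ρ(α^{k+1}, c^k, γ^k) − L_ρ(α^{k+1}, c^{k+1}, γ^k). -/
open Matrix

/-- The Euclidean (2-)norm on `ℝ^N`. -/
noncomputable def euclNorm {N : ℕ} (v : Fin N → ℝ) : ℝ :=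
  Real.sqrt (∑ i, v i ^ 2)

/-- The operator 2-norm of an `N × N` real matrix (as an operator on Euclidean space). -/
noncomputable def opNorm2 {N : ℕ} (M : Matrix (Fin N) (Fin N) ℝ) : ℝ :=
  ‖(Matrix.toEuclideanLin M).toContinuousLinearMap‖

/-- The augmented Lagrangian
`L_ρ(α, c, γ) = F(α) + λcᵀAc + γᵀ(α − Ac) + (ρ/2)‖α − Ac‖²`. -/
noncomputable def augLag {N : ℕ} (F : (Fin N → ℝ) → ℝ) (A : Matrix (Fin N) (Fin N) ℝ)
    (lam ρ : ℝ) (a c g : Fin N → ℝ) : ℝ :=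
  F a + lam * (c ⬝ᵥ A.mulVec c) + g ⬝ᵥ (a - A.mulVec c) +
    ρ / 2 * euclNorm (a - A.mulVec c) ^ 2

theorem euclNorm_sq {N : ℕ} (v : Fin N → ℝ) : euclNorm v ^ 2 = v ⬝ᵥ v := by
  rw [euclNorm, Real.sq_sqrt (Finset.sum_nonneg fun i _ => sq_nonneg (v i))]
  simp only [dotProduct, sq]

/-- Expansion of the augmented Lagrangian along a line in the `c` variable. -/
theorem augLag_add_smul {N : ℕ} (F : (Fin N → ℝ) → ℝ) (A : Matrix (Fin N) (Fin N) ℝ)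
    (lam ρ : ℝ) (a c g d : Fin N → ℝ) (t : ℝ) :
    augLag F A lam ρ a (c + t • d) g = augLag F A lam ρ a c g +
      (lam * (d ⬝ᵥ A.mulVec d) + ρ / 2 * euclNorm (A.mulVec d) ^ 2) * (t * t) +
      (lam * (c ⬝ᵥ A.mulVec d + d ⬝ᵥ A.mulVec c) - g ⬝ᵥ A.mulVec d -
        ρ * ((a - A.mulVec c) ⬝ᵥ A.mulVec d)) * t := by
  have hres : a - A.mulVec (c + t • d) = (a - A.mulVec c) - t • A.mulVec d := by
    rw [mulVec_add, mulVec_smul, sub_add_eq_sub_sub]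
  simp only [augLag, euclNorm_sq, hres]
  generalize a - A.mulVec c = r
  simp only [mulVec_add, mulVec_smul, dotProduct_add, add_dotProduct, dotProduct_sub,
    sub_dotProduct, dotProduct_smul, smul_dotProduct, smul_eq_mul]
  rw [dotProduct_comm (A.mulVec d) r]
  ring

/-- A quadratic without constant term that is nonnegative everywhere has no linear term. -/
theorem linear_coeff_eq_zero_of_nonneg {q l : ℝ} (h : ∀ t : ℝ, 0 ≤ q * (t * t) + l * t) :
    l = 0 := by
  have hd : discrim q l 0 ≤ 0 := discrim_le_zero fun t => by simpa using h t
  rw [discrim, mul_zero, sub_zero] at hd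
  exact pow_eq_zero_iff two_ne_zero |>.mp (le_antisymm hd (sq_nonneg l))

/-- **Sufficient decrease of the c-update (inequality (4.3))**: for every `k ≥ 0`,
`(ρ/2)‖A(c^{k+1} − c^k)‖² ≤ L_ρ(α^{k+1}, c^k, γ^k) − L_ρ(α^{k+1}, c^{k+1}, γ^k)`. -/
theorem admm_c_update_sufficient_decrease
    (N : ℕ) (hN : 0 < N) (A : Matrix (Fin N) (Fin N) ℝ)
    (hAsymm : A.IsSymm) (hA : A.PosDef)
    (lam ρ : ℝ) (hlam : 0 < lam) (hρ : 0 < ρ)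
    (F : (Fin N → ℝ) → ℝ) (hF0 : ∀ v, 0 ≤ F v) (hFlsc : LowerSemicontinuous F)
    (α c γ : ℕ → Fin N → ℝ)
    (hα : ∀ k, ∀ a : Fin N → ℝ,
      augLag F A lam ρ (α (k+1)) (c k) (γ k) ≤ augLag F A lam ρ a (c k) (γ k))
    (hc : ∀ k, ∀ b : Fin N → ℝ,
      augLag F A lam ρ (α (k+1)) (c (k+1)) (γ k) ≤ augLag F A lam ρ (α (k+1)) b (γ k))
    (hγ : ∀ k, γ (k+1) = γ k + ρ • (α (k+1) - A.mulVec (c (k+1))))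
    : ∀ k : ℕ,
      ρ / 2 * euclNorm (A.mulVec (c (k+1) - c k)) ^ 2 ≤
        augLag F A lam ρ (α (k+1)) (c k) (γ k) -
          augLag F A lam ρ (α (k+1)) (c (k+1)) (γ k) := by
  intro k
  set d := c (k + 1) - c k with hd
  have expand := augLag_add_smul F A lam ρ (α (k + 1)) (c (k + 1)) (γ k) d
  have linear_zero := linear_coeff_eq_zero_of_nonneg fun t =>
    nonneg_of_le_add_right <|
      (hc k (c (k + 1) + t • d)).trans_eq ((expand t).trans (add_assoc _ _ _))
  have hck : c (k + 1) + (-1 : ℝ) • d = c k := by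
    rw [hd, neg_one_smul, ← sub_eq_add_neg, sub_sub_cancel]
  have decrease := expand (-1)
  rw [linear_zero, hck] at decrease
  have quad_nonneg : 0 ≤ d ⬝ᵥ A.mulVec d := by
    simpa using hA.posSemidef.dotProduct_mulVec_nonneg d
  linarith [mul_nonneg hlam.le quad_nonneg]
end

section
/- Assume in addition that ρ > 4λ‖A⁻¹‖ and that the sequence ((α^k, c^k, γ^k))_{k≥1} converges to a point (α*, c*, γ*). Then α* = A c* and lim_{k→∞} F(α^k) = F(α*). -/
open Matrix

theorem continuous_augLag_zero {N : ℕ} (A : Matrix (Fin N) (Fin N) ℝ) (lam ρ : ℝ) :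
    Continuous fun p : (Fin N → ℝ) × (Fin N → ℝ) × (Fin N → ℝ) =>
      augLag (fun _ => 0) A lam ρ p.1 p.2.1 p.2.2 := by
  unfold augLag euclNorm
  fun_prop

theorem augLag_eq_add_augLag_zero {N : ℕ} (F : (Fin N → ℝ) → ℝ)
    (A : Matrix (Fin N) (Fin N) ℝ) (lam ρ : ℝ) (a c g : Fin N → ℝ) :
    augLag F A lam ρ a c g = F a + augLag (fun _ => 0) A lam ρ a c g := by
  unfold augLag
  ring

/-- **Feasibility and continuity of `F` along converging iterates ((4.22) and the limit
`F(α^k) → F(α*)` from the proof of Theorem 4.1)**: if `ρ > 4λ‖A⁻¹‖` and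
`(α^k, c^k, γ^k) → (α*, c*, γ*)`, then `α* = Ac*` and `F(α^k) → F(α*)`. -/
theorem admm_limit_feasibility_and_F_convergence
    (N : ℕ) (hN : 0 < N) (A : Matrix (Fin N) (Fin N) ℝ)
    (hAsymm : A.IsSymm) (hA : A.PosDef)
    (lam ρ : ℝ) (hlam : 0 < lam) (hρ : 0 < ρ)
    (F : (Fin N → ℝ) → ℝ) (hF0 : ∀ v, 0 ≤ F v) (hFlsc : LowerSemicontinuous F)
    (α c γ : ℕ → Fin N → ℝ)
    (hα : ∀ k, ∀ a : Fin N → ℝ,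
      augLag F A lam ρ (α (k+1)) (c k) (γ k) ≤ augLag F A lam ρ a (c k) (γ k))
    (hc : ∀ k, ∀ b : Fin N → ℝ,
      augLag F A lam ρ (α (k+1)) (c (k+1)) (γ k) ≤ augLag F A lam ρ (α (k+1)) b (γ k))
    (hγ : ∀ k, γ (k+1) = γ k + ρ • (α (k+1) - A.mulVec (c (k+1))))
    (hρbig : 4 * lam * opNorm2 A⁻¹ < ρ)
    (αstar cstar γstar : Fin N → ℝ)
    (hconv : Filter.Tendsto (fun k => (α k, c k, γ k)) Filter.atTop
      (nhds (αstar, cstar, γstar))) :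
    αstar = A.mulVec cstar ∧
    Filter.Tendsto (fun k => F (α k)) Filter.atTop (nhds (F αstar)) := by
  have hα_lim : Filter.Tendsto α Filter.atTop (nhds αstar) := hconv.fst_nhds
  have hc_lim : Filter.Tendsto c Filter.atTop (nhds cstar) := hconv.snd_nhds.fst_nhds
  have hγ_lim : Filter.Tendsto γ Filter.atTop (nhds γstar) := hconv.snd_nhds.snd_nhds
  have hα_succ := (Filter.tendsto_add_atTop_iff_nat 1).2 hα_lim
  have hc_succ := (Filter.tendsto_add_atTop_iff_nat 1).2 hc_lim
  have hγ_succ := (Filter.tendsto_add_atTop_iff_nat 1).2 hγ_lim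
  constructor
  · have hA_cont : Continuous fun v : Fin N → ℝ => A.mulVec v := by fun_prop
    have hstep := hγ_lim.add
      ((hα_succ.sub ((hA_cont.tendsto cstar).comp hc_succ)).const_smul ρ)
    have heq := tendsto_nhds_unique hγ_succ (hstep.congr fun k => (hγ k).symm)
    have hzero : ρ • (αstar - A.mulVec cstar) = 0 := left_eq_add.1 heq
    exact sub_eq_zero.1 ((smul_eq_zero.1 hzero).resolve_left hρ.ne')
  · have hcont := continuous_augLag_zero A lam ρ
    have hfixed := (hcont.tendsto (αstar, cstar, γstar)).comp
      (tendsto_const_nhds.prodMk_nhds (hc_lim.prodMk_nhds hγ_lim))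
    have hmoving := (hcont.tendsto (αstar, cstar, γstar)).comp
      (hα_succ.prodMk_nhds (hc_lim.prodMk_nhds hγ_lim))
    have hbound := (hfixed.sub hmoving).const_add (F αstar)
    rw [sub_self, add_zero] at hbound
    refine (Filter.tendsto_add_atTop_iff_nat 1).1 (tendsto_order.2 ⟨fun y hy => ?_, fun y hy => ?_⟩)
    · exact hα_succ.eventually (hFlsc αstar y hy)
    · filter_upwards [hbound.eventually_lt_const hy] with k hk
      have hmin := hα k αstar
      rw [augLag_eq_add_augLag_zero F, augLag_eq_add_augLag_zero F A lam ρ αstar] at hmin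
      simp only [Function.comp_apply] at hk
      linarith
end
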